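/- Suppose A x = b is consistent and x ∈ ℝ^n satisfies A_{I_p} x = b_{I_p}; write r := A_{I_r} x − b_{I_r}. Let S ∈ ℝ^{m_r×q} satisfy S^T r ≠ 0, set d := −P A_{I_r}^T S S^T r, and let P̃ ∈ ℝ^{n×t} be any matrix. Set p := (I − P̃ P̃†) d and suppose p ≠ 0 and ⟨p, x − A† b⟩ = −‖S^T r‖₂². Define δ := ‖S^T r‖₂² / ‖p‖₂² and x⁺ := x + δ p. Then ‖x⁺ − A† b‖₂² = ‖x − A† b‖₂² − ‖S^T r‖₂⁴ / ‖p‖₂² ≤ ‖x − A† b‖₂² − ‖S^T r‖₂² / ‖S^T A_{I_r} P‖₂²; that is, the orthogonalized direction yields a decrease at least as large as the plain stochastic-gradient step. -/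

import Mathlib

open Matrix

/-- The four Penrose conditions characterizing the Moore–Penrose pseudoinverse. -/
def IsMoorePenrose {k l : Type*} [Fintype k] [Fintype l]
    (A : Matrix k l ℝ) (B : Matrix l k ℝ) : Prop :=
  A * B * A = A ∧ B * A * B = B ∧ (A * B)ᵀ = A * B ∧ (B * A)ᵀ = B * A

/-- The spectral norm of a real matrix. -/
noncomputable def spec {k l : Type*} [Fintype k] [Fintype l] (A : Matrix k l ℝ) : ℝ :=
  Real.sqrt (sSup {t : ℝ | ∃ v : l → ℝ, v ⬝ᵥ v = 1 ∧ t = A.mulVec v ⬝ᵥ A.mulVec v})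

lemma dotProduct_sq_le {k : Type*} [Fintype k] (u v : k → ℝ) :
    (u ⬝ᵥ v) ^ 2 ≤ (u ⬝ᵥ u) * (v ⬝ᵥ v) := by
  simpa [dotProduct, sq] using Finset.sum_mul_sq_le_sq_mul_sq Finset.univ u v

lemma dotProduct_self_nonneg_real {k : Type*} [Fintype k] (u : k → ℝ) : 0 ≤ u ⬝ᵥ u :=
  Finset.sum_nonneg fun i _ => mul_self_nonneg (u i)

lemma dotProduct_self_pos_real {k : Type*} [Fintype k] {u : k → ℝ} (hu : u ≠ 0) : 0 < u ⬝ᵥ u :=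
  (dotProduct_self_nonneg_real u).lt_of_ne' (mt dotProduct_self_eq_zero.mp hu)

lemma bddAbove_mulVec_unit {k l : Type*} [Fintype k] [Fintype l] (A : Matrix k l ℝ) :
    BddAbove {t : ℝ | ∃ v : l → ℝ, v ⬝ᵥ v = 1 ∧ t = A.mulVec v ⬝ᵥ A.mulVec v} := by
  refine ⟨∑ i, A i ⬝ᵥ A i, ?_⟩
  rintro _ ⟨v, hv, rfl⟩
  refine Finset.sum_le_sum fun i _ => ?_
  have h := dotProduct_sq_le (A i) v
  rw [hv, mul_one, sq] at h
  exact h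

lemma spec_sq {k l : Type*} [Fintype k] [Fintype l] (A : Matrix k l ℝ) :
    spec A ^ 2 = sSup {t : ℝ | ∃ v : l → ℝ, v ⬝ᵥ v = 1 ∧ t = A.mulVec v ⬝ᵥ A.mulVec v} := by
  refine Real.sq_sqrt (Real.sSup_nonneg ?_)
  rintro _ ⟨v, -, rfl⟩
  exact dotProduct_self_nonneg_real _

/-- The spectral norm bounds the action of the matrix on every vector. -/
lemma mulVec_dotProduct_self_le {k l : Type*} [Fintype k] [Fintype l] (A : Matrix k l ℝ)
    (v : l → ℝ) : A.mulVec v ⬝ᵥ A.mulVec v ≤ spec A ^ 2 * (v ⬝ᵥ v) := by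
  rcases eq_or_ne v 0 with rfl | hv
  · simp
  have hpos := dotProduct_self_pos_real hv
  set c : ℝ := (√(v ⬝ᵥ v))⁻¹ with hc
  have hcc : c * c = (v ⬝ᵥ v)⁻¹ := by
    rw [hc, ← mul_inv, Real.mul_self_sqrt hpos.le]
  have hle : A.mulVec (c • v) ⬝ᵥ A.mulVec (c • v) ≤ spec A ^ 2 := by
    rw [spec_sq]
    refine le_csSup (bddAbove_mulVec_unit A) ⟨c • v, ?_, rfl⟩
    rw [smul_dotProduct, dotProduct_smul, smul_eq_mul, smul_eq_mul, ← mul_assoc, hcc,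
      inv_mul_cancel₀ hpos.ne']
  rw [mulVec_smul, smul_dotProduct, dotProduct_smul, smul_eq_mul, smul_eq_mul, ← mul_assoc,
    hcc, inv_mul_le_iff₀ hpos] at hle
  linarith

/-- The transpose of a matrix obeys the same spectral norm bound. -/
lemma transpose_mulVec_dotProduct_self_le {k l : Type*} [Fintype k] [Fintype l]
    (A : Matrix k l ℝ) (u : k → ℝ) :
    Aᵀ.mulVec u ⬝ᵥ Aᵀ.mulVec u ≤ spec A ^ 2 * (u ⬝ᵥ u) := by
  rcases eq_or_ne (Aᵀ.mulVec u) 0 with h0 | h0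
  · rw [h0, zero_dotProduct]
    exact mul_nonneg (sq_nonneg _) (dotProduct_self_nonneg_real u)
  have hpos := dotProduct_self_pos_real h0
  have hadj : Aᵀ.mulVec u ⬝ᵥ Aᵀ.mulVec u = u ⬝ᵥ A.mulVec (Aᵀ.mulVec u) := by
    rw [dotProduct_mulVec, ← mulVec_transpose, transpose_transpose, dotProduct_comm]
  have hcs := dotProduct_sq_le u (A.mulVec (Aᵀ.mulVec u))
  rw [← hadj] at hcs
  have hA := mul_le_mul_of_nonneg_left (mulVec_dotProduct_self_le A (Aᵀ.mulVec u))
    (dotProduct_self_nonneg_real u)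
  refine le_of_mul_le_mul_right ?_ hpos
  linarith

/-- An orthogonal projector does not increase the Euclidean norm. -/
lemma mulVec_dotProduct_self_le_of_projector {k : Type*} [Fintype k] {Q : Matrix k k ℝ}
    (hT : Qᵀ = Q) (hQ : Q * Q = Q) (d : k → ℝ) :
    Q.mulVec d ⬝ᵥ Q.mulVec d ≤ d ⬝ᵥ d := by
  have h : Q.mulVec d ⬝ᵥ Q.mulVec d = Q.mulVec d ⬝ᵥ d := by
    rw [dotProduct_mulVec, ← mulVec_transpose, hT, mulVec_mulVec, hQ]
  have h0 := dotProduct_self_nonneg_real (d - Q.mulVec d)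
  rw [sub_dotProduct, dotProduct_sub, dotProduct_sub, dotProduct_comm d (Q.mulVec d)] at h0
  linarith

/-- One step along an orthogonalized direction: with
`d := −P A_{I_r}ᵀ S Sᵀ r`, `p := (I − P̃ P̃†) d ≠ 0` satisfying
`⟨p, x − A†b⟩ = −‖Sᵀ r‖₂²`, `δ := ‖Sᵀ r‖₂²/‖p‖₂²` and `x⁺ := x + δ p`, one has
`‖x⁺ − A†b‖₂² = ‖x − A†b‖₂² − ‖Sᵀ r‖₂⁴/‖p‖₂²
  ≤ ‖x − A†b‖₂² − ‖Sᵀ r‖₂²/‖Sᵀ A_{I_r} P‖₂²`. -/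
theorem stmt17 {m n q t : ℕ} (A : Matrix (Fin m) (Fin n) ℝ) (b : Fin m → ℝ)
    (Ip : Finset (Fin m))
    (Ap : Matrix {i // i ∈ Ip} (Fin n) ℝ) (hApdef : Ap = A.submatrix Subtype.val id)
    (Ar : Matrix {i // i ∈ Ipᶜ} (Fin n) ℝ) (hArdef : Ar = A.submatrix Subtype.val id)
    (Ad : Matrix (Fin n) (Fin m) ℝ) (hAd : IsMoorePenrose A Ad)
    (Apd : Matrix (Fin n) {i // i ∈ Ip} ℝ) (hApd : IsMoorePenrose Ap Apd)
    (P : Matrix (Fin n) (Fin n) ℝ) (hP : P = 1 - Apd * Ap)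
    (bp : {i // i ∈ Ip} → ℝ) (hbp : bp = fun i => b i.1)
    (br : {i // i ∈ Ipᶜ} → ℝ) (hbr : br = fun i => b i.1)
    (hcons : ∃ xs : Fin n → ℝ, A.mulVec xs = b)
    (x : Fin n → ℝ) (hx : Ap.mulVec x = bp)
    (r : {i // i ∈ Ipᶜ} → ℝ) (hr : r = Ar.mulVec x - br)
    (S : Matrix {i // i ∈ Ipᶜ} (Fin q) ℝ) (hS : Sᵀ.mulVec r ≠ 0)
    (d : Fin n → ℝ) (hd : d = -((P * Arᵀ * S).mulVec (Sᵀ.mulVec r)))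
    (Pt : Matrix (Fin n) (Fin t) ℝ)
    (Ptd : Matrix (Fin t) (Fin n) ℝ) (hPtd : IsMoorePenrose Pt Ptd)
    (p : Fin n → ℝ) (hp : p = (1 - Pt * Ptd).mulVec d)
    (hpne : p ≠ 0)
    (hpx : p ⬝ᵥ (x - Ad.mulVec b) = -(Sᵀ.mulVec r ⬝ᵥ Sᵀ.mulVec r))
    (δ : ℝ) (hδ : δ = (Sᵀ.mulVec r ⬝ᵥ Sᵀ.mulVec r) / (p ⬝ᵥ p))
    (xplus : Fin n → ℝ) (hxplus : xplus = x + δ • p) :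
    (xplus - Ad.mulVec b) ⬝ᵥ (xplus - Ad.mulVec b)
        = (x - Ad.mulVec b) ⬝ᵥ (x - Ad.mulVec b)
          - (Sᵀ.mulVec r ⬝ᵥ Sᵀ.mulVec r) ^ 2 / (p ⬝ᵥ p) ∧
      (xplus - Ad.mulVec b) ⬝ᵥ (xplus - Ad.mulVec b)
        ≤ (x - Ad.mulVec b) ⬝ᵥ (x - Ad.mulVec b)
          - (Sᵀ.mulVec r ⬝ᵥ Sᵀ.mulVec r) / spec (Sᵀ * (Ar * P)) ^ 2 := by
  have hpos := dotProduct_self_pos_real hpne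
  have hspos := dotProduct_self_pos_real hS
  have hPT : Pᵀ = P := by
    rw [hP, transpose_sub, transpose_one, hApd.2.2.2]
  have hdM : d = -((Sᵀ * (Ar * P))ᵀ.mulVec (Sᵀ.mulVec r)) := by
    rw [hd, transpose_mul, transpose_mul, transpose_transpose, hPT]
  have hpd : p ⬝ᵥ p ≤ d ⬝ᵥ d := by
    rw [hp]
    refine mulVec_dotProduct_self_le_of_projector ?_ ?_ d
    · rw [transpose_sub, transpose_one, hPtd.2.2.1]
    · have hidem : Pt * Ptd * (Pt * Ptd) = Pt * Ptd := by
        rw [← Matrix.mul_assoc, hPtd.1]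
      rw [sub_mul, mul_sub, mul_sub, hidem]
      simp
  have hdd : d ⬝ᵥ d ≤ spec (Sᵀ * (Ar * P)) ^ 2 * (Sᵀ.mulVec r ⬝ᵥ Sᵀ.mulVec r) := by
    rw [hdM, neg_dotProduct_neg]
    exact transpose_mulVec_dotProduct_self_le _ _
  have heq : (xplus - Ad.mulVec b) ⬝ᵥ (xplus - Ad.mulVec b)
      = (x - Ad.mulVec b) ⬝ᵥ (x - Ad.mulVec b)
        - (Sᵀ.mulVec r ⬝ᵥ Sᵀ.mulVec r) ^ 2 / (p ⬝ᵥ p) := by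
    have hsplit : xplus - Ad.mulVec b = (x - Ad.mulVec b) + δ • p := by
      rw [hxplus]; abel
    rw [hsplit, add_dotProduct, dotProduct_add, dotProduct_add, smul_dotProduct,
      smul_dotProduct, dotProduct_smul, dotProduct_smul,
      dotProduct_comm (x - Ad.mulVec b) p, hpx, hδ]
    simp only [smul_eq_mul]
    field_simp
    ring
  refine ⟨heq, heq.trans_le (sub_le_sub_left ?_ _)⟩
  have hpp := hpd.trans hdd
  have hspec : 0 < spec (Sᵀ * (Ar * P)) ^ 2 :=
    pos_of_mul_pos_left (hpos.trans_le hpp) hspos.le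
  rw [div_le_div_iff₀ hspec hpos]
  have hmul := mul_le_mul_of_nonneg_left hpp hspos.le
  linarith
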